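/- Let f be a function on datasets with ℓ₂-sensitivity Δ, and let 0 < ε and 0 < δ < 1. If σ² > 2·ln(1.25/δ)·Δ²/ε², then for ε ≤ 1 the Gaussian mechanism M(I) = f(I) + N(0, σ²·I_D) satisfies (ε, δ)-differential privacy: for all neighboring datasets I₁, I₂ and all measurable sets S, P[M(I₁) ∈ S] ≤ e^ε·P[M(I₂) ∈ S] + δ. -/

import Mathlib

open MeasureTheory ProbabilityTheory

/-- The Gaussian mechanism: add i.i.d. `N(0, σ²)` noise to each coordinate of `f I`,
i.e. the output distribution is the product of Gaussians centered at the coordinates of `f I`. -/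
noncomputable def gaussianMechanism {Dataset : Type*} (D : ℕ)
    (f : Dataset → (Fin D → ℝ)) (σ2 : ℝ) (I : Dataset) : Measure (Fin D → ℝ) :=
  Measure.pi (fun i => gaussianReal (f I i) σ2.toNNReal)

open scoped ENNReal NNReal

theorem lintegral_fin_nat_prod_eq_prod {n : ℕ} {E : Fin n → Type*}
    {mE : ∀ i, MeasurableSpace (E i)} {μ : (i : Fin n) → Measure (E i)} [∀ i, SigmaFinite (μ i)]
    {f : (i : Fin n) → E i → ℝ≥0∞} (hf : ∀ i, Measurable (f i)) :
    ∫⁻ x : (i : Fin n) → E i, ∏ i, f i (x i) ∂(Measure.pi μ) = ∏ i, ∫⁻ x, f i x ∂(μ i) := by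
  induction n with
  | zero => simp
  | succ n n_ih =>
    rw [← ((measurePreserving_piFinSuccAbove μ 0).symm).lintegral_comp_emb
      (MeasurableEquiv.measurableEmbedding _), Fin.prod_univ_succ,
      ← n_ih fun i ↦ hf i.succ, ← lintegral_prod_mul (hf 0).aemeasurable]
    · simp_rw [MeasurableEquiv.piFinSuccAbove_symm_apply, Fin.insertNthEquiv,
        Fin.prod_univ_succ, Fin.insertNth_zero, Equiv.coe_fn_mk, Fin.cons_succ,
        Fin.cons_zero]
      rfl
    · exact (Finset.measurable_prod _ fun i _ ↦
        (hf i.succ).comp (measurable_pi_apply i)).aemeasurable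

theorem pi_withDensity_fin {n : ℕ} {E : Fin n → Type*}
    {mE : ∀ i, MeasurableSpace (E i)} {μ : (i : Fin n) → Measure (E i)} [∀ i, SigmaFinite (μ i)]
    {f : (i : Fin n) → E i → ℝ≥0∞} (hf : ∀ i, Measurable (f i))
    [∀ i, SigmaFinite ((μ i).withDensity (f i))] :
    Measure.pi (fun i ↦ (μ i).withDensity (f i)) =
      (Measure.pi μ).withDensity fun x ↦ ∏ i, f i (x i) := by
  refine Measure.pi_eq fun s hs ↦ ?_
  rw [withDensity_apply _ (MeasurableSet.univ_pi hs), Measure.restrict_pi_pi,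
    lintegral_fin_nat_prod_eq_prod hf]
  exact Finset.prod_congr rfl fun i _ ↦ (withDensity_apply _ (hs i)).symm

/-- The density of the Gaussian measure on `ℝⁿ` with mean `m` and covariance `v • 1`. -/
noncomputable def piGaussianPDFReal {n : ℕ} (m : Fin n → ℝ) (v : ℝ≥0) (x : Fin n → ℝ) : ℝ :=
  (√(2 * Real.pi * v))⁻¹ ^ n * Real.exp (-(∑ i, (x i - m i) ^ 2) / (2 * v))

theorem piGaussianPDFReal_nonneg {n : ℕ} (m : Fin n → ℝ) (v : ℝ≥0) (x : Fin n → ℝ) :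
    0 ≤ piGaussianPDFReal m v x := by
  unfold piGaussianPDFReal
  positivity

theorem measurable_piGaussianPDFReal {n : ℕ} (m : Fin n → ℝ) (v : ℝ≥0) :
    Measurable (piGaussianPDFReal m v) := by
  unfold piGaussianPDFReal
  fun_prop

theorem pi_gaussianReal_eq_withDensity {n : ℕ} (m : Fin n → ℝ) {v : ℝ≥0} (hv : v ≠ 0) :
    Measure.pi (fun i ↦ gaussianReal (m i) v) =
      volume.withDensity fun x ↦ ENNReal.ofReal (piGaussianPDFReal m v x) := by
  have (i : Fin n) : SigmaFinite ((volume : Measure ℝ).withDensity (gaussianPDF (m i) v)) := by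
    rw [← gaussianReal_of_var_ne_zero _ hv]
    infer_instance
  simp_rw [gaussianReal_of_var_ne_zero _ hv]
  rw [pi_withDensity_fin fun i ↦ measurable_gaussianPDF (m i) v, volume_pi]
  congr 1 with x
  simp_rw [gaussianPDF_def]
  rw [← ENNReal.ofReal_prod_of_nonneg fun i _ ↦ gaussianPDFReal_nonneg _ _ _]
  simp_rw [gaussianPDFReal_def, piGaussianPDFReal, Finset.prod_mul_distrib, ← Real.exp_sum,
    ← Finset.sum_div, Finset.sum_neg_distrib]
  simp

theorem one_le_exp_neg_add_mul_exp_mul {c : ℝ} (hc : 2 / 5 ≤ c) (y : ℝ) :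
    1 ≤ Real.exp (-y) + 3 / 5 * Real.exp (c * y) := by
  rcases le_total y 0 with hy | hy
  · have := Real.one_le_exp (neg_nonneg.2 hy)
    linarith [Real.exp_pos (c * y)]
  · have hw0 := Real.exp_pos (-y)
    have hw1 : Real.exp (-y) ≤ 1 := Real.exp_le_one_iff.2 (by linarith)
    have hbern := rpow_one_add_le_one_add_mul_self (s := Real.exp (-y) - 1) (p := 2 / 5)
      (by linarith) (by norm_num) (by norm_num)
    rw [add_sub_cancel, ← Real.exp_mul] at hbern
    have hmul : Real.exp (-y * (2 / 5)) * Real.exp (2 / 5 * y) = 1 := by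
      rw [← Real.exp_add, ← Real.exp_zero]
      congr 1
      ring
    have hmono : Real.exp (2 / 5 * y) ≤ Real.exp (c * y) := by gcongr
    have hE := Real.exp_pos (2 / 5 * y)
    generalize Real.exp (-y) = w at *
    generalize Real.exp (2 / 5 * y) = E at *
    have hu : 1 ≤ (1 + 2 / 5 * (w - 1)) * E :=
      hmul.ge.trans (mul_le_mul_of_nonneg_right hbern hE.le)
    have hsu : (1 - w) * (1 + 2 / 5 * (w - 1)) ≤ 3 / 5 := by nlinarith
    nlinarith [mul_le_mul_of_nonneg_left hu (sub_nonneg.2 hw1),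
      mul_le_mul_of_nonneg_right hsu hE.le]

theorem piGaussianPDFReal_le {n : ℕ} (a b : Fin n → ℝ) {v : ℝ≥0} (hv : v ≠ 0) {c : ℝ}
    (hc : 2 / 5 ≤ c) (ε : ℝ) (x : Fin n → ℝ) :
    piGaussianPDFReal a v x ≤ Real.exp ε * piGaussianPDFReal b v x +
      3 / 5 * Real.exp ((c + c ^ 2) * (∑ i, (a i - b i) ^ 2) / (2 * v) - c * ε) *
        piGaussianPDFReal (fun i ↦ a i + c * (a i - b i)) v x := by
  have hv' : (v : ℝ) ≠ 0 := by exact_mod_cast hv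
  have hb : ∑ i, (x i - b i) ^ 2 = ∑ i, (x i - a i) ^ 2 +
      2 * ∑ i, (x i - a i) * (a i - b i) + ∑ i, (a i - b i) ^ 2 := by
    rw [Finset.mul_sum, ← Finset.sum_add_distrib, ← Finset.sum_add_distrib]
    exact Finset.sum_congr rfl fun i _ ↦ by ring
  have hc' : ∑ i, (x i - (a i + c * (a i - b i))) ^ 2 = ∑ i, (x i - a i) ^ 2 -
      2 * c * ∑ i, (x i - a i) * (a i - b i) + c ^ 2 * ∑ i, (a i - b i) ^ 2 := by
    rw [Finset.mul_sum, Finset.mul_sum, ← Finset.sum_sub_distrib, ← Finset.sum_add_distrib]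
    exact Finset.sum_congr rfl fun i _ ↦ by ring
  unfold piGaussianPDFReal
  rw [hb, hc']
  generalize ∑ i, (x i - a i) ^ 2 = A
  generalize ∑ i, (x i - a i) * (a i - b i) = W
  generalize ∑ i, (a i - b i) ^ 2 = Q
  have key := one_le_exp_neg_add_mul_exp_mul hc ((2 * W + Q) / (2 * v) - ε)
  have h₁ : Real.exp ε * Real.exp (-(A + 2 * W + Q) / (2 * v)) =
      Real.exp (-A / (2 * v)) * Real.exp (-((2 * W + Q) / (2 * v) - ε)) := by
    rw [← Real.exp_add, ← Real.exp_add]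
    congr 1
    field_simp
    ring
  have h₂ : Real.exp ((c + c ^ 2) * Q / (2 * v) - c * ε) *
      Real.exp (-(A - 2 * c * W + c ^ 2 * Q) / (2 * v)) =
      Real.exp (-A / (2 * v)) * Real.exp (c * ((2 * W + Q) / (2 * v) - ε)) := by
    rw [← Real.exp_add, ← Real.exp_add]
    congr 1
    field_simp
    ring
  calc _ ≤ (√(2 * Real.pi * v))⁻¹ ^ n * Real.exp (-A / (2 * v)) *
        (Real.exp (-((2 * W + Q) / (2 * v) - ε)) +
          3 / 5 * Real.exp (c * ((2 * W + Q) / (2 * v) - ε))) :=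
        le_mul_of_one_le_right (by positivity) key
    _ = _ := by
        linear_combination (-(√(2 * Real.pi * v))⁻¹ ^ n) * h₁ -
          3 / 5 * (√(2 * Real.pi * v))⁻¹ ^ n * h₂

theorem pi_gaussianReal_le {n : ℕ} (a b : Fin n → ℝ) {v : ℝ≥0} (hv : v ≠ 0) {c : ℝ}
    (hc : 2 / 5 ≤ c) (ε : ℝ) {S : Set (Fin n → ℝ)} (hS : MeasurableSet S) :
    Measure.pi (fun i ↦ gaussianReal (a i) v) S ≤
      ENNReal.ofReal (Real.exp ε) * Measure.pi (fun i ↦ gaussianReal (b i) v) S +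
        ENNReal.ofReal
          (3 / 5 * Real.exp ((c + c ^ 2) * (∑ i, (a i - b i) ^ 2) / (2 * v) - c * ε)) := by
  set K := 3 / 5 * Real.exp ((c + c ^ 2) * (∑ i, (a i - b i) ^ 2) / (2 * v) - c * ε)
  have hK0 : 0 ≤ K := by positivity
  calc Measure.pi (fun i ↦ gaussianReal (a i) v) S
      ≤ ENNReal.ofReal (Real.exp ε) * Measure.pi (fun i ↦ gaussianReal (b i) v) S +
        ENNReal.ofReal K *
          Measure.pi (fun i ↦ gaussianReal (a i + c * (a i - b i)) v) S := by
        rw [pi_gaussianReal_eq_withDensity a hv, pi_gaussianReal_eq_withDensity b hv,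
          pi_gaussianReal_eq_withDensity (fun i ↦ a i + c * (a i - b i)) hv,
          withDensity_apply _ hS, withDensity_apply _ hS, withDensity_apply _ hS,
          ← lintegral_const_mul _ (measurable_piGaussianPDFReal b v).ennreal_ofReal,
          ← lintegral_const_mul _ (measurable_piGaussianPDFReal _ v).ennreal_ofReal,
          ← lintegral_add_left
            ((measurable_piGaussianPDFReal b v).ennreal_ofReal.const_mul _)]
        refine lintegral_mono fun x ↦ ?_
        rw [← ENNReal.ofReal_mul (Real.exp_nonneg _), ← ENNReal.ofReal_mul hK0,
          ← ENNReal.ofReal_add (mul_nonneg (Real.exp_nonneg _) (piGaussianPDFReal_nonneg _ _ _))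
            (mul_nonneg hK0 (piGaussianPDFReal_nonneg _ _ _))]
        exact ENNReal.ofReal_le_ofReal (piGaussianPDFReal_le a b hv hc ε x)
    _ ≤ _ := by
        gcongr
        exact mul_le_of_le_one_right' prob_le_one

theorem exp_half_le_two : Real.exp (1 / 2) ≤ 2 := by
  have h : Real.exp (1 / 2) ^ 2 = Real.exp 1 := by
    rw [← Real.exp_nat_mul]
    norm_num
  nlinarith [Real.exp_one_lt_d9, Real.exp_pos (1 / 2)]

theorem stmt_15 {Dataset : Type*} (Neighbor : Dataset → Dataset → Prop) (D : ℕ)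
    (f : Dataset → (Fin D → ℝ)) (Δ ε δ σ2 : ℝ) (hΔ : 0 ≤ Δ)
    (hsens : ∀ I₁ I₂, Neighbor I₁ I₂ →
      Real.sqrt (∑ i, (f I₁ i - f I₂ i) ^ 2) ≤ Δ)
    (hε : 0 < ε) (hε1 : ε ≤ 1) (hδ : 0 < δ) (hδ1 : δ < 1)
    (hσ : 2 * Real.log (1.25 / δ) * Δ ^ 2 / ε ^ 2 < σ2) :
    ∀ I₁ I₂, Neighbor I₁ I₂ → ∀ S : Set (Fin D → ℝ), MeasurableSet S →
      gaussianMechanism D f σ2 I₁ S ≤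
        ENNReal.ofReal (Real.exp ε) * gaussianMechanism D f σ2 I₂ S + ENNReal.ofReal δ := by
  intro I₁ I₂ hN S hS
  have hQ : ∑ i, (f I₁ i - f I₂ i) ^ 2 ≤ Δ ^ 2 := (Real.sqrt_le_left hΔ).1 (hsens I₁ I₂ hN)
  unfold gaussianMechanism
  rcases hΔ.eq_or_lt with rfl | hΔ
  · have hab : f I₁ = f I₂ := by
      funext i
      have h := (Finset.single_le_sum (f := fun i ↦ (f I₁ i - f I₂ i) ^ 2)
        (fun i _ ↦ sq_nonneg _) (Finset.mem_univ i)).trans hQ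
      nlinarith
    rw [hab]
    refine le_add_right (le_mul_of_one_le_left' ?_)
    exact ENNReal.one_le_ofReal.2 (Real.one_le_exp hε.le)
  set l := Real.log (1.25 / δ) with hl_def
  have hl : 1 / 5 ≤ l := by
    have : Real.log 1.25 ≤ l :=
      Real.log_le_log (by norm_num) (le_div_self (by norm_num) hδ hδ1.le)
    have := Real.one_sub_inv_le_log_of_pos (x := 1.25) (by norm_num)
    norm_num at this ⊢
    linarith
  rw [div_lt_iff₀ (by positivity)] at hσ
  have hσ0 : 0 < σ2 := by
    have : 0 < 2 * l * Δ ^ 2 := by positivity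
    exact pos_of_mul_pos_left (this.trans hσ) (by positivity)
  have hv : ((σ2.toNNReal : ℝ≥0) : ℝ) = σ2 := Real.coe_toNNReal _ hσ0.le
  have hcε : 2 * l < σ2 * ε / Δ ^ 2 * ε := by
    rw [div_mul_eq_mul_div, lt_div_iff₀ (by positivity)]
    linarith
  have hc0 : 0 < σ2 * ε / Δ ^ 2 := by positivity
  have hc : 2 / 5 ≤ σ2 * ε / Δ ^ 2 := by nlinarith
  refine (pi_gaussianReal_le (f I₁) (f I₂) (Real.toNNReal_pos.2 hσ0).ne' hc ε hS).trans ?_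
  rw [hv]
  gcongr
  have hcΔ : σ2 * ε / Δ ^ 2 * Δ ^ 2 = σ2 * ε := by field_simp
  set c := σ2 * ε / Δ ^ 2
  have hexp : (c + c ^ 2) * (∑ i, (f I₁ i - f I₂ i) ^ 2) / (2 * σ2) - c * ε ≤ 1 / 2 + -l := by
    have : (c + c ^ 2) * (∑ i, (f I₁ i - f I₂ i) ^ 2) / (2 * σ2) ≤ (1 + c) * ε / 2 := by
      rw [div_le_iff₀ (by positivity)]
      calc _ ≤ (c + c ^ 2) * Δ ^ 2 := by gcongr
        _ = _ := by linear_combination (1 + c) * hcΔ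
    linarith
  calc _ ≤ 3 / 5 * Real.exp (1 / 2 + -l) := by gcongr
    _ = 3 / 5 * (Real.exp (1 / 2) * (δ / 1.25)) := by
        rw [Real.exp_add, Real.exp_neg, hl_def, Real.exp_log (by positivity), inv_div]
    _ ≤ 3 / 5 * (2 * (δ / 1.25)) := by gcongr; exact exp_half_le_two
    _ ≤ δ := by norm_num; linarith
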